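/- There exists a Borel linear subspace L of X = ℝ^ω such that: (1) L is Haar-thin in X; (2) L is null-finite in X; (3) L cannot be covered by countably many closed Haar-meager subsets of X; and (4) L does not belong to the Kuczma–Ger class 𝓒_X, i.e., there exists a discontinuous additive function f : X → ℝ whose image f[L] is a bounded subset of ℝ (indeed f[L] = {0}). -/

import Mathlib

open Set Filter Topology Pointwise MeasureTheory

/-- A Borel set `A` in a topological Abelian group is *Haar-meager* if there is a continuous
map `f` from the Cantor cube `ℕ → Bool` such that `f ⁻¹' (A + x)` is meager for every `x`. -/
def HaarMeager {X : Type*} [TopologicalSpace X] [AddCommGroup X] (A : Set X) : Prop :=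
  ∃ f : (ℕ → Bool) → X, Continuous f ∧ ∀ x : X, IsMeagre (f ⁻¹' ((fun a => a + x) '' A))

/-- A set `A` is *Haar-null* if there is a Borel probability measure `μ` on `X` such that
`μ (A + x) = 0` for every `x ∈ X`. -/
def HaarNull {X : Type*} [MeasurableSpace X] [AddCommGroup X] (A : Set X) : Prop :=
  ∃ μ : Measure X, IsProbabilityMeasure μ ∧ ∀ x : X, μ ((fun a => a + x) '' A) = 0

/-- A subset `T` of the Cantor cube is *thin* if for every coordinate `n`, any two elements
of `T` agreeing at all coordinates except possibly `n` are equal. -/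
def IsThinSet (T : Set (ℕ → Bool)) : Prop :=
  ∀ n : ℕ, ∀ s ∈ T, ∀ t ∈ T, (∀ m : ℕ, m ≠ n → s m = t m) → s = t

/-- A set `A` is *Haar-thin* if there is a continuous map `f` from the Cantor cube such that
`f ⁻¹' (A + x)` is thin for every `x`. -/
def HaarThin {X : Type*} [TopologicalSpace X] [AddCommGroup X] (A : Set X) : Prop :=
  ∃ f : (ℕ → Bool) → X, Continuous f ∧ ∀ x : X, IsThinSet (f ⁻¹' ((fun a => a + x) '' A))

/-- A set `A` is *null-finite* if there is a null sequence `(x n)` such that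
`{n | x n + y ∈ A}` is finite for every `y`. -/
def NullFinite {X : Type*} [TopologicalSpace X] [AddCommGroup X] (A : Set X) : Prop :=
  ∃ x : ℕ → X, Tendsto x atTop (nhds 0) ∧ ∀ y : X, {n : ℕ | x n + y ∈ A}.Finite

/-- A set `A` is *Haar-open* if for every compact `K` and `p ∈ K` there is `x` such that
`K ∩ (A + x)` is a neighborhood of `p` in the subspace `K`. -/
def HaarOpen {X : Type*} [TopologicalSpace X] [AddCommGroup X] (A : Set X) : Prop :=
  ∀ K : Set X, IsCompact K → ∀ p ∈ K, ∃ x : X,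
    K ∩ ((fun a => a + x) '' A) ∈ nhdsWithin p K

/-- A proper linear subspace is Haar-thin. -/
theorem haarThin_of_notMem {L : Submodule ℝ (ℕ → ℝ)} {v : ℕ → ℝ} (hv : v ∉ L) :
    HaarThin (L : Set (ℕ → ℝ)) := by
  refine ⟨fun s => (cantorSetHomeomorphNatToBool.symm s : ℝ) • v, by fun_prop, ?_⟩
  rintro x n s ⟨a, ha, has⟩ t ⟨b, hb, hbt⟩ -
  have h : ((cantorSetHomeomorphNatToBool.symm s : ℝ) - cantorSetHomeomorphNatToBool.symm t) • v
      ∈ L := by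
    have h1 : a - b ∈ L := L.sub_mem ha hb
    have h2 : a - b = (a + x) - (b + x) := by abel
    rw [h2] at h1
    simp only at has hbt
    rwa [has, hbt, ← sub_smul] at h1
  by_contra hst
  refine hv ((L.smul_mem_iff ?_).1 h)
  rw [sub_ne_zero]
  intro h'
  exact hst (cantorSetHomeomorphNatToBool.symm.injective (Subtype.ext h'))

/-- A proper linear subspace is null-finite. -/
theorem nullFinite_of_notMem {L : Submodule ℝ (ℕ → ℝ)} {v : ℕ → ℝ} (hv : v ∉ L) :
    NullFinite (L : Set (ℕ → ℝ)) := by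
  refine ⟨fun n => (1 / ((n : ℝ) + 1)) • v, ?_, fun y => ?_⟩
  · have := (tendsto_one_div_add_atTop_nhds_zero_nat (𝕜 := ℝ)).smul_const v
    rwa [zero_smul] at this
  · refine Set.Subsingleton.finite fun m hm n hn => ?_
    have h1 := L.sub_mem hm hn
    rw [add_sub_add_right_eq_sub, ← sub_smul] at h1
    by_contra hmn
    refine hv ((L.smul_mem_iff ?_).1 h1)
    rw [sub_ne_zero]
    intro h
    rw [one_div, one_div, inv_inj] at h
    exact hmn (by exact_mod_cast add_right_cancel h)

/-- A proper linear subspace lies in the kernel of a discontinuous additive function. -/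
theorem exists_discontinuous_additive_of_notMem {L : Submodule ℝ (ℕ → ℝ)} {v : ℕ → ℝ}
    (hv : v ∉ L) :
    ∃ f : (ℕ → ℝ) → ℝ, (∀ x y : ℕ → ℝ, f (x + y) = f x + f y) ∧ ¬ Continuous f ∧
      ∀ x ∈ L, f x = 0 := by
  let M : Submodule ℚ (ℕ → ℝ) := L.restrictScalars ℚ ⊔ Submodule.span ℚ {v}
  have hM : (√2 : ℝ) • v ∉ M := by
    intro h
    obtain ⟨l, hl, w, hw, hlw⟩ := Submodule.mem_sup.1 h
    obtain ⟨q, rfl⟩ := Submodule.mem_span_singleton.1 hw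
    have h1 : (√2 - (q : ℝ)) • v ∈ L := by
      have : (√2 - (q : ℝ)) • v = l := by
        rw [sub_smul, ← hlw, Rat.cast_smul_eq_qsmul]; abel
      rw [this]; exact hl
    refine hv ((L.smul_mem_iff ?_).1 h1)
    rw [sub_ne_zero]
    exact irrational_sqrt_two.ne_rat q
  obtain ⟨g, hg, hgM⟩ := Submodule.exists_le_ker_of_notMem hM
  refine ⟨fun x => (g x : ℝ), fun x y => by simp, fun hc => ?_, fun x hx => ?_⟩
  · have h1 : Continuous fun r : ℝ => (g (r • v) : ℝ) := hc.comp (by fun_prop)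
    have h2 : (fun r : ℝ => (g (r • v) : ℝ)) = fun _ => 0 := by
      refine Continuous.ext_on Rat.isDenseEmbedding_coe_real.dense h1 continuous_const ?_
      rintro _ ⟨q, rfl⟩
      have : q • v ∈ M := Submodule.mem_sup_right
        (Submodule.smul_mem _ _ (Submodule.mem_span_singleton_self v))
      have := hgM this
      simpa [Rat.cast_smul_eq_qsmul] using this
    have h3 := congrFun h2 √2
    exact hg (by exact_mod_cast h3)
  · have : x ∈ M := Submodule.mem_sup_left hx
    have := hgM this
    simpa using this

/-- The linear span of a measurably parametrized linearly independent family is Borel. -/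
theorem measurableSet_span_image {Z : Type*} [MeasurableSpace Z] [StandardBorelSpace Z]
    {φ : Z → ℕ → ℝ} (hφ : Measurable φ) {G : Set Z} (hG : MeasurableSet G)
    (hli : LinearIndepOn ℝ φ G) :
    MeasurableSet (Submodule.span ℝ (φ '' G) : Set (ℕ → ℝ)) := by
  obtain ⟨g, hg⟩ := exists_measurableEmbedding_real Z
  let S : (m : ℕ) → Set ((Fin m → ℝ) × (Fin m → Z)) := fun m =>
    {p | (∀ i, p.1 i ≠ 0) ∧ (∀ i, p.2 i ∈ G) ∧ ∀ i j, i < j → g (p.2 i) < g (p.2 j)}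
  let Ψ : (m : ℕ) → (Fin m → ℝ) × (Fin m → Z) → ℕ → ℝ := fun m p => ∑ i, p.1 i • φ (p.2 i)
  have hmono : ∀ m, ∀ p ∈ S m, StrictMono fun i => g (p.2 i) := fun m p hp i j hij =>
    hp.2.2 i j hij
  have hinj : ∀ m, ∀ p ∈ S m, Function.Injective p.2 := fun m p hp =>
    Function.Injective.of_comp (f := g) (hmono m p hp).injective
  let l : (m : ℕ) → (Fin m → ℝ) × (Fin m → Z) → Z →₀ ℝ := fun m p =>
    Finsupp.mapDomain p.2 (Finsupp.equivFunOnFinite.symm p.1)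
  have hl : ∀ m p, Finsupp.linearCombination ℝ φ (l m p) = Ψ m p := by
    intro m p
    simp only [l, Ψ, Finsupp.linearCombination_mapDomain]
    rw [Finsupp.linearCombination_apply, Finsupp.sum_fintype _ _ (by simp)]
    simp
  have hsupp : ∀ m, ∀ p ∈ S m, ((l m p).support : Set Z) = range p.2 := by
    classical
    intro m p hp
    simp only [l]
    rw [Finsupp.mapDomain_support_of_injective (hinj m p hp), Finset.coe_image]
    have : ((Finsupp.equivFunOnFinite.symm p.1).support : Set (Fin m)) = univ := by
      ext i; simpa using hp.1 i
    rw [this, image_univ]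
  have hsuppG : ∀ m, ∀ p ∈ S m, l m p ∈ Finsupp.supported ℝ ℝ G := by
    intro m p hp
    rw [Finsupp.mem_supported, hsupp m p hp]
    rintro _ ⟨i, rfl⟩
    exact hp.2.1 i
  have hSm : ∀ m, MeasurableSet (S m) := by
    intro m
    have hgm := hg.measurable
    have h1 : ∀ i : Fin m, Measurable fun p : (Fin m → ℝ) × (Fin m → Z) => p.1 i := fun i =>
      (measurable_pi_apply i).comp measurable_fst
    have h2 : ∀ i : Fin m, Measurable fun p : (Fin m → ℝ) × (Fin m → Z) => p.2 i := fun i =>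
      (measurable_pi_apply i).comp measurable_snd
    simp only [S, ofPred_and, ofPred_forall]
    refine MeasurableSet.inter (MeasurableSet.iInter fun i => ?_)
      (MeasurableSet.inter (MeasurableSet.iInter fun i => ?_)
        (MeasurableSet.iInter fun i => MeasurableSet.iInter fun j =>
          MeasurableSet.iInter fun _ => ?_))
    · exact (h1 i) (measurableSet_singleton 0).compl
    · exact h2 i hG
    · exact measurableSet_lt (hgm.comp (h2 i)) (hgm.comp (h2 j))
  have hΨ : ∀ m, Measurable (Ψ m) := by
    intro m
    refine Finset.measurable_sum _ fun i _ => ?_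
    exact ((measurable_pi_apply i).comp measurable_fst).smul
      (hφ.comp ((measurable_pi_apply i).comp measurable_snd))
  have hΨinj : ∀ m, InjOn (Ψ m) (S m) := by
    intro m p hp q hq hpq
    rw [← hl, ← hl] at hpq
    have hlpq : l m p = l m q :=
      linearIndepOn_iffₛ.1 hli _ (hsuppG m p hp) _ (hsuppG m q hq) hpq
    have hr : range p.2 = range q.2 := by rw [← hsupp m p hp, ← hsupp m q hq, hlpq]
    have hr' : range (fun i => g (p.2 i)) = range fun i => g (q.2 i) := by
      rw [← Function.comp_def g p.2, ← Function.comp_def g q.2, range_comp, range_comp, hr]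
    have h2 : p.2 = q.2 := by
      funext i
      exact hg.injective (congrFun (((hmono m p hp).range_inj (hmono m q hq)).1 hr') i)
    have h1 : p.1 = q.1 := by
      simp only [l] at hlpq
      rw [h2] at hlpq
      exact Finsupp.equivFunOnFinite.symm.injective
        (Finsupp.mapDomain_injective (hinj m q hq) hlpq)
    exact Prod.ext h1 h2
  have hspan : (Submodule.span ℝ (φ '' G) : Set (ℕ → ℝ)) = ⋃ m, Ψ m '' S m := by
    ext x
    simp only [SetLike.mem_coe, mem_iUnion]
    constructor
    · intro hx
      obtain ⟨c, hc, rfl⟩ := (Finsupp.mem_span_image_iff_linearCombination ℝ).1 hx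
      let _ : LinearOrder Z := LinearOrder.lift' g hg.injective
      let e := c.support.orderEmbOfFin rfl
      have he : ∀ i, e i ∈ c.support := fun i => Finset.orderEmbOfFin_mem _ rfl i
      refine ⟨c.support.card, (fun i => c (e i), e), ⟨fun i => ?_, fun i => ?_,
        fun i j hij => ?_⟩, ?_⟩
      · exact Finsupp.mem_support_iff.1 (he i)
      · exact hc (he i)
      · exact e.strictMono hij
      · simp only [Ψ, Finsupp.linearCombination_apply, Finsupp.sum]
        rw [← Finset.sum_coe_sort c.support]
        exact Fintype.sum_equiv (c.support.orderIsoOfFin rfl).toEquiv _ _ fun i => rfl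
    · rintro ⟨m, p, hp, rfl⟩
      rw [← hl]
      exact (Finsupp.mem_span_image_iff_linearCombination ℝ).2 ⟨_, hsuppG m p hp, rfl⟩
  rw [hspan]
  exact MeasurableSet.iUnion fun m => (hSm m).image_of_measurable_injOn (hΨ m) (hΨinj m)

/-- If countably many closed sets cover a dense `G_δ` subset of a nonempty `G_δ` set `⋂ n, O n` in
a Polish space, then one of them contains a nonempty relatively open subset of `⋂ n, O n`. -/
theorem exists_isOpen_inter_subset_of_cover {Z : Type*} [TopologicalSpace Z] [PolishSpace Z]
    {O U K : ℕ → Set Z} (hO : ∀ n, IsOpen (O n)) (hU : ∀ n, IsOpen (U n))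
    (hK : ∀ n, IsClosed (K n)) (hne : (⋂ n, O n).Nonempty)
    (hdense : ∀ m, ⋂ n, O n ⊆ closure ((⋂ n, O n) ∩ U m))
    (hcover : (⋂ n, O n) ∩ ⋂ n, U n ⊆ ⋃ n, K n) :
    ∃ k, ∃ W : Set Z, IsOpen W ∧ (W ∩ ⋂ n, O n).Nonempty ∧ W ∩ (⋂ n, O n) ⊆ K k := by
  set C := ⋂ n, O n with hC
  have : PolishSpace (closure C) := isClosed_closure.polishSpace
  have hdense' : ∀ A : Set Z, C ⊆ closure (C ∩ A) →
      Dense ((↑) ⁻¹' A : Set (closure C)) := by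
    intro A hA
    rw [Subtype.dense_iff]
    refine (closure_minimal hA isClosed_closure).trans (closure_mono ?_)
    rintro x ⟨hx, hxA⟩
    exact ⟨⟨x, subset_closure hx⟩, hxA, rfl⟩
  by_contra! hcon
  have hKd : ∀ k, Dense ((↑) ⁻¹' (K k)ᶜ : Set (closure C)) := by
    refine fun k => hdense' _ fun x hx => mem_closure_iff.2 fun W hW hxW => ?_
    obtain ⟨y, hy, hyK⟩ := not_subset.1 (hcon k W hW ⟨x, hxW, hx⟩)
    exact ⟨y, hy.1, hy.2, hyK⟩
  have hOd : ∀ k, Dense ((↑) ⁻¹' (O k) : Set (closure C)) := by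
    refine fun k => hdense' _ ?_
    rw [inter_eq_left.2 (iInter_subset O k)]
    exact subset_closure
  have hall : Dense (⋂ k, ((↑) ⁻¹' (O k ∩ U k ∩ (K k)ᶜ) : Set (closure C))) := by
    refine dense_iInter_of_isOpen (fun k => ?_) fun k => ?_
    · exact (((hO k).inter (hU k)).inter (hK k).isOpen_compl).preimage continuous_subtype_val
    · refine Dense.inter_of_isOpen_right ?_ (hKd k)
        ((hK k).isOpen_compl.preimage continuous_subtype_val)
      exact (hOd k).inter_of_isOpen_right (hdense' _ (hdense k))
        ((hU k).preimage continuous_subtype_val)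
  have : Nonempty (closure C) := ⟨⟨_, subset_closure hne.some_mem⟩⟩
  obtain ⟨x, hx⟩ := hall.nonempty
  simp only [mem_iInter, mem_preimage, mem_inter_iff] at hx
  obtain ⟨k, hk⟩ := mem_iUnion.1
    (hcover ⟨mem_iInter.2 fun n => (hx n).1.1, mem_iInter.2 fun n => (hx n).1.2⟩)
  exact (hx k).2 hk

/-- A natural number coding the initial segment `j 0, …, j n`. -/
def initialCode (j : ℕ → ℕ) : ℕ → ℕ
  | 0 => j 0
  | n + 1 => Nat.pair (initialCode j n) (j (n + 1)) + 1

theorem le_initialCode (j : ℕ → ℕ) (n : ℕ) : n ≤ initialCode j n := by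
  induction n with
  | zero => exact Nat.zero_le _
  | succ n ih => exact Nat.succ_le_succ (ih.trans (Nat.left_le_pair _ _))

theorem apply_le_initialCode (j : ℕ → ℕ) (n : ℕ) : j n ≤ initialCode j n := by
  cases n with
  | zero => exact le_rfl
  | succ n => exact (Nat.right_le_pair _ _).trans (Nat.le_succ _)

theorem eq_of_initialCode_eq {j k : ℕ → ℕ} {n : ℕ} (h : initialCode j n = initialCode k n) :
    ∀ i ≤ n, j i = k i := by
  induction n with
  | zero => intro i hi; rwa [Nat.le_zero.1 hi]
  | succ n ih =>
    obtain ⟨h1, h2⟩ := Nat.pair_eq_pair.1 (Nat.succ_injective h)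
    intro i hi
    rcases Nat.le_succ_iff.1 hi with hi | rfl
    · exact ih h1 i hi
    · exact h2

theorem continuous_initialCode (n : ℕ) : Continuous fun j : ℕ → ℕ => initialCode j n := by
  induction n with
  | zero => exact continuous_apply 0
  | succ n ih =>
    exact (continuous_of_discreteTopology (f := fun p : ℕ × ℕ => Nat.pair p.1 p.2 + 1)).comp
      (ih.prodMk (continuous_apply (n + 1)))

/-- The sequence whose `n`-th term lies at distance `z.2 n` from a factorial that codes
`z.1 0, …, z.1 n`. -/
noncomputable def codedSequence (z : (ℕ → ℕ) × (ℕ → ℝ)) (n : ℕ) : ℝ :=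
  ((initialCode z.1 n + 1).factorial : ℝ) + z.2 n

theorem continuous_codedSequence : Continuous codedSequence := by
  refine continuous_pi fun n => ?_
  have h : Continuous fun z : (ℕ → ℕ) × (ℕ → ℝ) => ((initialCode z.1 n + 1).factorial : ℝ) :=
    (continuous_of_discreteTopology (f := fun k : ℕ => ((k + 1).factorial : ℝ))).comp
      ((continuous_initialCode n).comp continuous_fst)
  exact h.add ((continuous_apply n).comp continuous_snd)

/-- The parameters for which `z.1 n` bounds `|z.2 n|` and, if odd, codes an approximation of
`z.2 0, …, z.2 (n - 1)`. -/
def admissibleAt (n : ℕ) : Set ((ℕ → ℕ) × (ℕ → ℝ)) :=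
  {z | |z.2 n| < z.1 n ∧
    (Odd (z.1 n) → ∀ i < n,
      |z.2 i - TopologicalSpace.denseSeq (ℕ → ℝ) (z.1 n / 2) i| < 1 / (n + 1))}

/-- The parameters whose integer part has an odd term at time `m` or later. -/
def approximatedAfter (m : ℕ) : Set ((ℕ → ℕ) × (ℕ → ℝ)) :=
  {z | ∃ n, m ≤ n ∧ Odd (z.1 n)}

/-- The admissible parameters whose real part is approximated infinitely often. -/
def genericParameters : Set ((ℕ → ℕ) × (ℕ → ℝ)) :=
  (⋂ n, admissibleAt n) ∩ ⋂ m, approximatedAfter m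

theorem isOpen_admissibleAt (n : ℕ) : IsOpen (admissibleAt n) := by
  have hj : Continuous fun z : (ℕ → ℕ) × (ℕ → ℝ) => z.1 n :=
    (continuous_apply n).comp continuous_fst
  have ht : ∀ i, Continuous fun z : (ℕ → ℕ) × (ℕ → ℝ) => z.2 i := fun i =>
    (continuous_apply i).comp continuous_snd
  have hf : ∀ f : ℕ → ℝ, Continuous fun z : (ℕ → ℕ) × (ℕ → ℝ) => f (z.1 n) := fun f =>
    (continuous_of_discreteTopology (f := f)).comp hj
  refine (isOpen_lt (ht n).abs (hf _)).inter ?_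
  have h : {z : (ℕ → ℕ) × (ℕ → ℝ) | Odd (z.1 n) → ∀ i < n,
      |z.2 i - TopologicalSpace.denseSeq (ℕ → ℝ) (z.1 n / 2) i| < 1 / (n + 1)} =
      {z | z.1 n ∈ {k | ¬ Odd k}} ∪ ⋂ i ∈ Finset.range n,
        {z | |z.2 i - TopologicalSpace.denseSeq (ℕ → ℝ) (z.1 n / 2) i| < 1 / (n + 1)} := by
    ext z
    simp [imp_iff_not_or]
  change IsOpen {z : (ℕ → ℕ) × (ℕ → ℝ) | Odd (z.1 n) → ∀ i < n,
      |z.2 i - TopologicalSpace.denseSeq (ℕ → ℝ) (z.1 n / 2) i| < 1 / (n + 1)}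
  rw [h]
  refine ((isOpen_discrete _).preimage hj).union (isOpen_biInter_finset fun i _ => ?_)
  exact isOpen_lt ((ht i).sub (hf fun k => TopologicalSpace.denseSeq (ℕ → ℝ) (k / 2) i)).abs
    continuous_const

theorem isOpen_approximatedAfter (m : ℕ) : IsOpen (approximatedAfter m) := by
  have h : approximatedAfter m = ⋃ n, ⋃ (_ : m ≤ n), {z | z.1 n ∈ {k | Odd k}} := by
    ext z
    simp [approximatedAfter]
  rw [h]
  exact isOpen_iUnion fun n => isOpen_iUnion fun _ =>
    (isOpen_discrete _).preimage ((continuous_apply n).comp continuous_fst)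

theorem measurableSet_genericParameters : MeasurableSet genericParameters :=
  (MeasurableSet.iInter fun n => (isOpen_admissibleAt n).measurableSet).inter
    (MeasurableSet.iInter fun n => (isOpen_approximatedAfter n).measurableSet)

theorem eventually_initialCode_ne {z w : (ℕ → ℕ) × (ℕ → ℝ)} (hz : z ∈ genericParameters)
    (hw : w ∈ genericParameters) (hzw : z ≠ w) :
    ∀ᶠ n in atTop, initialCode z.1 n ≠ initialCode w.1 n := by
  by_contra hcon
  have hfreq : ∃ᶠ n in atTop, initialCode z.1 n = initialCode w.1 n := by
    simpa [Filter.Frequently] using hcon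
  have h1 : z.1 = w.1 := by
    funext i
    obtain ⟨n, hn, h⟩ := frequently_atTop.1 hfreq i
    exact eq_of_initialCode_eq h i hn
  have h2 : z.2 = w.2 := by
    funext i
    refine eq_of_forall_dist_le fun ε hε => ?_
    obtain ⟨m, hm⟩ := exists_nat_gt (2 / ε)
    obtain ⟨n, hn, hodd⟩ := mem_iInter.1 hz.2 (max m (i + 1))
    have hzn := (mem_iInter.1 hz.1 n).2 hodd i (by omega)
    have hwn := (mem_iInter.1 hw.1 n).2 (h1 ▸ hodd) i (by omega)
    rw [← h1] at hwn
    have hmn : (m : ℝ) ≤ n := by exact_mod_cast (le_max_left _ _).trans hn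
    have hb : 2 * (1 / ((n : ℝ) + 1)) ≤ ε := by
      rw [mul_one_div, div_le_iff₀ (by positivity)]
      rw [div_lt_iff₀ hε] at hm
      nlinarith
    rw [Real.dist_eq]
    rw [abs_lt] at hzn hwn
    rw [abs_le]
    constructor <;> linarith
  exact hzw (Prod.ext h1 h2)

theorem codedSequence_bounds {z : (ℕ → ℕ) × (ℕ → ℝ)} (hz : z ∈ genericParameters) (n : ℕ) :
    ((initialCode z.1 n + 1).factorial : ℝ) ≤ 2 * codedSequence z n ∧
      codedSequence z n ≤ 2 * ((initialCode z.1 n + 1).factorial : ℝ) := by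
  have h := (mem_iInter.1 hz.1 n).1
  have h1 : ((z.1 n : ℕ) : ℝ) ≤ initialCode z.1 n := by
    exact_mod_cast apply_le_initialCode z.1 n
  have h2 : 2 * ((initialCode z.1 n : ℕ) : ℝ) ≤ ((initialCode z.1 n + 1).factorial : ℝ) := by
    have : ∀ k : ℕ, 2 * k ≤ (k + 1).factorial := by
      intro k
      rcases k with _ | k
      · simp
      · rw [Nat.factorial_succ]
        exact Nat.mul_le_mul (by omega) (Nat.self_le_factorial _)
    exact_mod_cast this _
  rw [abs_lt] at h
  unfold codedSequence
  constructor <;> linarith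

theorem codedSequence_le_of_initialCode_lt {z w : (ℕ → ℕ) × (ℕ → ℝ)}
    (hz : z ∈ genericParameters) (hw : w ∈ genericParameters) {n : ℕ}
    (h : initialCode z.1 n < initialCode w.1 n) :
    |codedSequence z n| * (n + 1) ≤ 4 * codedSequence w n := by
  obtain ⟨hz1, hz2⟩ := codedSequence_bounds hz n
  obtain ⟨hw1, -⟩ := codedSequence_bounds hw n
  have hpos : 0 ≤ codedSequence z n := by
    have : (0 : ℝ) ≤ ((initialCode z.1 n + 1).factorial : ℝ) := Nat.cast_nonneg _
    linarith
  have hf : ((initialCode z.1 n + 1).factorial : ℝ) * (n + 1) ≤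
      ((initialCode w.1 n + 1).factorial : ℝ) := by
    have h1 : (initialCode z.1 n + 1).factorial * (n + 1) ≤ (initialCode z.1 n + 2).factorial := by
      rw [Nat.factorial_succ (initialCode z.1 n + 1), mul_comm]
      exact Nat.mul_le_mul_right _ (by have := le_initialCode z.1 n; omega)
    exact_mod_cast h1.trans (Nat.factorial_le (by omega))
  rw [abs_of_nonneg hpos]
  have hn : (0 : ℝ) ≤ (n : ℝ) + 1 := by positivity
  nlinarith [mul_le_mul_of_nonneg_right hz2 hn]

theorem exists_lt_abs_sum_codedSequence {s : Finset ((ℕ → ℕ) × (ℕ → ℝ))} (hne : s.Nonempty)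
    (hs : ∀ z ∈ s, z ∈ genericParameters) {r : (ℕ → ℕ) × (ℕ → ℝ) → ℝ} (hr : ∀ z ∈ s, r z ≠ 0)
    (B : ℝ) : ∃ n, B < |∑ z ∈ s, r z * codedSequence z n| := by
  classical
  obtain ⟨y, hy, hymin⟩ := s.exists_min_image (fun z => |r z|) hne
  have hρ : 0 < |r y| := abs_pos.2 (hr y hy)
  set R := ∑ z ∈ s, |r z| with hR
  have hev : ∀ᶠ n in atTop, ∀ z ∈ s, ∀ w ∈ s, z ≠ w → initialCode z.1 n ≠ initialCode w.1 n := by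
    refine (Finset.eventually_all s).2 fun z hz => (Finset.eventually_all s).2 fun w hw => ?_
    by_cases hzw : z = w
    · simp [hzw]
    · filter_upwards [eventually_initialCode_ne (hs z hz) (hs w hw) hzw] with n hn _ using hn
  have hlarge1 : ∀ᶠ n : ℕ in atTop, 8 * R / |r y| ≤ (n : ℝ) :=
    tendsto_natCast_atTop_atTop.eventually_ge_atTop _
  have hlarge2 : ∀ᶠ n : ℕ in atTop, 4 * |B| / |r y| ≤ (n : ℝ) :=
    tendsto_natCast_atTop_atTop.eventually_ge_atTop _
  obtain ⟨n, hn, hn1, hn2⟩ := (hev.and (hlarge1.and hlarge2)).exists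
  rw [div_le_iff₀ hρ] at hn1 hn2
  refine ⟨n, ?_⟩
  obtain ⟨x, hx, hxmax⟩ := s.exists_max_image (fun z => initialCode z.1 n) hne
  set X := codedSequence x n with hX
  have hXn : (n : ℝ) + 1 ≤ 2 * X := by
    refine le_trans ?_ (codedSequence_bounds (hs x hx) n).1
    have : n + 1 ≤ (initialCode x.1 n + 1).factorial :=
      (Nat.succ_le_succ (le_initialCode x.1 n)).trans (Nat.self_le_factorial _)
    exact_mod_cast this
  have hrest : |∑ z ∈ s.erase x, r z * codedSequence z n| * (n + 1) ≤ R * (4 * X) := by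
    calc |∑ z ∈ s.erase x, r z * codedSequence z n| * (n + 1)
        ≤ (∑ z ∈ s.erase x, |r z * codedSequence z n|) * (n + 1) := by
          gcongr; exact Finset.abs_sum_le_sum_abs _ _
      _ = ∑ z ∈ s.erase x, |r z| * (|codedSequence z n| * (n + 1)) := by
          rw [Finset.sum_mul]
          exact Finset.sum_congr rfl fun z _ => by rw [abs_mul, mul_assoc]
      _ ≤ ∑ z ∈ s.erase x, |r z| * (4 * X) := by
          refine Finset.sum_le_sum fun z hz => ?_
          obtain ⟨hzx, hz⟩ := Finset.mem_erase.1 hz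
          refine mul_le_mul_of_nonneg_left ?_ (abs_nonneg _)
          exact codedSequence_le_of_initialCode_lt (hs z hz) (hs x hx)
            (lt_of_le_of_ne (hxmax z hz) (hn z hz x hx hzx))
      _ ≤ R * (4 * X) := by
          rw [← Finset.sum_mul]
          have : ∑ z ∈ s.erase x, |r z| ≤ R :=
            Finset.sum_le_sum_of_subset_of_nonneg (Finset.erase_subset _ _)
              fun _ _ _ => abs_nonneg _
          have hX0 : 0 ≤ X := by
            have : (0 : ℝ) ≤ n := Nat.cast_nonneg n
            linarith
          gcongr
  rw [← Finset.add_sum_erase s _ hx]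
  set E := ∑ z ∈ s.erase x, r z * codedSequence z n
  have hn0 : (0 : ℝ) ≤ n := Nat.cast_nonneg n
  have hX0 : 0 < X := by linarith
  have hE : |E| ≤ |r y| * X / 2 := by
    have h1 : |E| * (n + 1) ≤ (|r y| * X / 2) * (n + 1) := by nlinarith
    exact le_of_mul_le_mul_right h1 (by positivity)
  have hmain : |r y| * X ≤ |r x * X| := by
    rw [abs_mul, abs_of_pos hX0]
    exact mul_le_mul_of_nonneg_right (hymin x hx) hX0.le
  have htri : |r x * X| - |E| ≤ |r x * X + E| := by
    have := abs_sub_abs_le_abs_sub (r x * X) (-E)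
    rwa [abs_neg, sub_neg_eq_add] at this
  have hB : |B| < |r y| * X / 2 := by nlinarith
  linarith [le_abs_self B]

theorem linearIndepOn_codedSequence : LinearIndepOn ℝ codedSequence genericParameters := by
  rw [linearIndepOn_iff]
  intro l hl h0
  by_contra hne
  obtain ⟨n, hn⟩ := exists_lt_abs_sum_codedSequence (Finsupp.support_nonempty_iff.2 hne)
    (fun z hz => hl hz) (fun z hz => Finsupp.mem_support_iff.1 hz) 0
  have := congrFun h0 n
  rw [Finsupp.linearCombination_apply, Finsupp.sum, Finset.sum_apply] at this
  simp only [Pi.smul_apply, smul_eq_mul, Pi.zero_apply] at this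
  rw [this, abs_zero] at hn
  exact lt_irrefl _ hn

theorem one_notMem_span_codedSequence :
    (1 : ℕ → ℝ) ∉ Submodule.span ℝ (codedSequence '' genericParameters) := by
  intro h
  obtain ⟨l, hl, h1⟩ := (Finsupp.mem_span_image_iff_linearCombination ℝ).1 h
  have hne : l ≠ 0 := by
    rintro rfl
    simp at h1
  obtain ⟨n, hn⟩ := exists_lt_abs_sum_codedSequence (Finsupp.support_nonempty_iff.2 hne)
    (fun z hz => hl hz) (fun z hz => Finsupp.mem_support_iff.1 hz) 1
  have := congrFun h1 n
  rw [Finsupp.linearCombination_apply, Finsupp.sum, Finset.sum_apply] at this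
  simp only [Pi.smul_apply, smul_eq_mul, Pi.one_apply] at this
  rw [this, abs_one] at hn
  exact lt_irrefl _ hn

/-- The parameter that agrees with `z` before time `N` and with `w` from then on. -/
def splice (N : ℕ) (z w : (ℕ → ℕ) × (ℕ → ℝ)) : (ℕ → ℕ) × (ℕ → ℝ) :=
  (fun i => if i < N then z.1 i else w.1 i, fun i => if i < N then z.2 i else w.2 i)

theorem tendsto_splice (z : (ℕ → ℕ) × (ℕ → ℝ)) (w : ℕ → (ℕ → ℕ) × (ℕ → ℝ)) :
    Tendsto (fun N => splice N z (w N)) atTop (𝓝 z) := by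
  refine Tendsto.prodMk_nhds (tendsto_pi_nhds.2 fun i => ?_) (tendsto_pi_nhds.2 fun i => ?_) <;>
  · refine tendsto_const_nhds.congr' ?_
    filter_upwards [eventually_gt_atTop i] with N hN
    simp [hN]

theorem splice_mem_admissibleAt {N n : ℕ} (hn : n < N) {z w : (ℕ → ℕ) × (ℕ → ℝ)}
    (hz : z ∈ admissibleAt n) : splice N z w ∈ admissibleAt n := by
  refine ⟨by simpa [splice, hn] using hz.1, fun hodd i hi => ?_⟩
  have := hz.2 (by simpa [splice, hn] using hodd) i hi
  simpa [splice, hn, hi.trans hn] using this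

theorem subset_closure_inter_approximatedAfter (m : ℕ) :
    ⋂ n, admissibleAt n ⊆ closure ((⋂ n, admissibleAt n) ∩ approximatedAfter m) := by
  intro z hz
  have hidx : ∀ N : ℕ, ∃ k, ∀ i < N,
      |z.2 i - TopologicalSpace.denseSeq (ℕ → ℝ) k i| < 1 / (N + 1) := by
    intro N
    have hopen : IsOpen (⋂ i ∈ Finset.range N, {t : ℕ → ℝ | |z.2 i - t i| < 1 / (N + 1)}) :=
      isOpen_biInter_finset fun i _ =>
        isOpen_lt (continuous_const.sub (continuous_apply i)).abs continuous_const
    obtain ⟨k, hk⟩ := (TopologicalSpace.denseRange_denseSeq (ℕ → ℝ)).exists_mem_open hopen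
      ⟨z.2, by simp; intros; positivity⟩
    exact ⟨k, by simpa using hk⟩
  choose k hk using hidx
  refine mem_closure_of_tendsto
    (tendsto_splice z fun N => (fun i => if i = N then 2 * k N + 1 else 2, 0)) ?_
  filter_upwards [eventually_ge_atTop m] with N hN
  refine ⟨mem_iInter.2 fun n => ?_, N, hN, by simp [splice]⟩
  rcases lt_trichotomy n N with hn | rfl | hn
  · exact splice_mem_admissibleAt hn (mem_iInter.1 hz n)
  · refine ⟨?_, fun _ i hi => ?_⟩
    · simp only [splice, lt_irrefl, if_false, if_true, Pi.zero_apply, abs_zero]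
      positivity
    · have hdiv : (2 * k n + 1) / 2 = k n := by omega
      simpa [splice, hi, hdiv] using hk n i hi
  · have h1 : ¬ n < N := by omega
    have h2 : n ≠ N := by omega
    refine ⟨by simp [splice, h1, h2], fun hodd => ?_⟩
    simp only [splice, h1, h2, if_false] at hodd
    exact absurd hodd (by decide)

theorem nonempty_iInter_admissibleAt : (⋂ n, admissibleAt n).Nonempty :=
  ⟨(fun _ => 2, 0), mem_iInter.2 fun n => ⟨by simp, fun h => absurd h (show ¬ Odd 2 by decide)⟩⟩

/-- A set containing the coded sequences of a nonempty relatively open set of admissible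
parameters is not Haar-meager. -/
theorem not_haarMeager_of_codedSequence_mem {F : Set (ℕ → ℝ)} {W : Set ((ℕ → ℕ) × (ℕ → ℝ))}
    (hW : IsOpen W) (hne : (W ∩ ⋂ n, admissibleAt n).Nonempty)
    (hWF : W ∩ (⋂ n, admissibleAt n) ⊆ codedSequence ⁻¹' F) : ¬ HaarMeager F := by
  rintro ⟨f, hf, hmeagre⟩
  obtain ⟨z₀, hz₀W, hz₀⟩ := hne
  have hbound : ∀ i, ∃ M : ℕ, ∀ s, |f s i| < M := by
    intro i
    obtain ⟨C, hC⟩ := isCompact_univ.exists_bound_of_continuousOn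
      ((continuous_apply i).comp hf).continuousOn
    obtain ⟨M, hM⟩ := exists_nat_gt C
    exact ⟨M, fun s => (hC s (mem_univ s)).trans_lt hM⟩
  choose M hM using hbound
  let p : ℕ → Bool := fun _ => false
  obtain ⟨N, hN⟩ := ((tendsto_splice z₀ fun _ => (fun i => 2 * M i, f p)).eventually
    (hW.mem_nhds hz₀W)).exists
  set z₁ := splice N z₀ (fun i => 2 * M i, f p) with hz₁
  let ζ : (ℕ → Bool) → (ℕ → ℕ) × (ℕ → ℝ) := fun s => (z₁.1, z₁.2 + (f s - f p))
  have hζ : Continuous ζ := by fun_prop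
  have hζp : ζ p = z₁ := by simp [ζ]
  have hev : ∀ᶠ s in 𝓝 p, ζ s ∈ W ∧ ∀ n ∈ Finset.range N, ζ s ∈ admissibleAt n := by
    refine (hζ.continuousAt.eventually (hW.mem_nhds (hζp ▸ hN))).and
      ((Finset.eventually_all _).2 fun n hn =>
        hζ.continuousAt.eventually ((isOpen_admissibleAt n).mem_nhds ?_))
    rw [hζp]
    exact splice_mem_admissibleAt (Finset.mem_range.1 hn) (mem_iInter.1 hz₀ n)
  have hsub : {s | ζ s ∈ W ∧ ∀ n ∈ Finset.range N, ζ s ∈ admissibleAt n} ⊆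
      f ⁻¹' ((fun a => a + (f p - codedSequence z₁)) '' F) := by
    rintro s ⟨hsW, hs⟩
    refine ⟨codedSequence (ζ s), hWF ⟨hsW, mem_iInter.2 fun n => ?_⟩, ?_⟩
    · by_cases hn : n < N
      · exact hs n (Finset.mem_range.2 hn)
      · have hpos := (abs_nonneg _).trans_lt (hM n s)
        refine ⟨?_, fun hodd => ?_⟩
        · simp only [ζ, hz₁, splice, hn, if_false, Pi.add_apply, Pi.sub_apply,
            add_sub_cancel]
          push_cast
          linarith [hM n s]
        · simp only [ζ, hz₁, splice, hn, if_false] at hodd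
          exact absurd (even_two_mul (M n)) (Nat.not_even_iff_odd.2 hodd)
    · funext i
      simp only [Pi.add_apply, Pi.sub_apply, codedSequence, ζ]
      ring
  have hdense := dense_of_mem_residual (hmeagre (f p - codedSequence z₁))
  obtain ⟨s, hs, hsF⟩ := mem_closure_iff_nhds.1 (hdense p) _ hev
  exact hsF (hsub hs)

/-- `ℝ^ω` contains a Borel linear subspace `L` which is Haar-thin and null-finite, cannot be
covered by countably many closed Haar-meager sets, and does not belong to the Kuczma–Ger
class `𝓒`: there is a discontinuous additive functional vanishing on `L`. -/
theorem statement2 :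
    ∃ L : Submodule ℝ (ℕ → ℝ),
      MeasurableSet (L : Set (ℕ → ℝ)) ∧
      HaarThin (L : Set (ℕ → ℝ)) ∧
      NullFinite (L : Set (ℕ → ℝ)) ∧
      (∀ F : ℕ → Set (ℕ → ℝ), (∀ n, IsClosed (F n)) → (∀ n, HaarMeager (F n)) →
        ¬ (L : Set (ℕ → ℝ)) ⊆ ⋃ n, F n) ∧
      ∃ f : (ℕ → ℝ) → ℝ,
        (∀ x y : ℕ → ℝ, f (x + y) = f x + f y) ∧
        ¬ Continuous f ∧
        (∀ x ∈ L, f x = 0) := by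
  have hv := one_notMem_span_codedSequence
  refine ⟨Submodule.span ℝ (codedSequence '' genericParameters),
    measurableSet_span_image continuous_codedSequence.measurable measurableSet_genericParameters
      linearIndepOn_codedSequence,
    haarThin_of_notMem hv, nullFinite_of_notMem hv, fun F hF hFm hcover => ?_,
    exists_discontinuous_additive_of_notMem hv⟩
  obtain ⟨k, W, hW, hne, hWF⟩ := exists_isOpen_inter_subset_of_cover isOpen_admissibleAt
    isOpen_approximatedAfter (fun n => (hF n).preimage continuous_codedSequence)
    nonempty_iInter_admissibleAt subset_closure_inter_approximatedAfter
    (fun z hz => by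
      rw [← preimage_iUnion]
      exact hcover (Submodule.subset_span ⟨z, hz, rfl⟩))
  exact not_haarMeager_of_codedSequence_mem hW hne hWF (hFm k)
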